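/- Let T_b = inf{t ≥ 1 : Z_t ≥ b} be the first passage time of a real-valued process (Z_t)_{t≥1} over level b > 0, and suppose (1/t)Z_t converges r-completely to I ∈ (0,∞) for an integer r ≥ 1. Then limsup_{b→∞} E[T_b^r]/b^r ≤ I^{−r}; combined with the matching lower bound from the SLLN, lim_{b→∞} E[T_b^r]/b^r = I^{−r}. -/

import Mathlib

open MeasureTheory Filter ENNReal

lemma aux_pow (m k : ℕ) (hm : 1 ≤ m) :
    (m + 1) ^ (k + 1) + m ^ k ≤ m ^ (k + 1) + 2 ^ (k + 1) * m ^ k := by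
  induction k with
  | zero => simp
  | succ k ih =>
    have h1 : m ^ k ≤ m ^ (k + 1) := Nat.pow_le_pow_right hm (Nat.le_succ k)
    have h2 := Nat.mul_le_mul_right (m + 1) ih
    obtain ⟨c, hc⟩ : ∃ c, 2 ^ (k + 1) = c + 1 :=
      ⟨2 ^ (k + 1) - 1, (Nat.sub_add_cancel Nat.one_le_two_pow).symm⟩
    have h3 : c * m ^ k ≤ c * m ^ (k + 1) := Nat.mul_le_mul_left _ h1
    have e1 : m ^ k * m = m ^ (k + 1) := (pow_succ _ _).symm
    have e2 : m ^ (k + 1) * m = m ^ (k + 1 + 1) := (pow_succ _ _).symm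
    have e3 : (m + 1) ^ (k + 1) * (m + 1) = (m + 1) ^ (k + 1 + 1) := (pow_succ _ _).symm
    have e4 : (2 : ℕ) ^ (k + 1 + 1) = 2 * 2 ^ (k + 1) := by ring
    rw [e4, ← e3, ← e2, hc]
    rw [hc] at h2
    have h4 : (c + 1) * m ^ k * m = (c + 1) * m ^ (k + 1) := by rw [mul_assoc, e1]
    linarith

open Classical in
lemma aux_bound (B : ℕ → Prop) (k N T : ℕ) (hB : ∀ s, N < s + 1 → s + 1 < T → B s) :
    ∀ n, n < T → (n + 1) ^ (k + 1) ≤ (N + 1) ^ (k + 1) +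
      2 ^ (k + 1) * ∑ s ∈ Finset.range n, (if B s then (s + 1) ^ k else 0) := by
  intro n
  induction n with
  | zero =>
    intro _
    have : 1 ≤ (N + 1) ^ (k + 1) := Nat.one_le_pow _ _ (by omega)
    simpa using this
  | succ n ih =>
    intro hn
    have h := ih (by omega)
    by_cases hN : n + 1 ≤ N
    · exact le_add_right (Nat.pow_le_pow_left (by omega) _)
    · have hb := hB n (by omega) hn
      rw [Finset.sum_range_succ, if_pos hb]
      have := aux_pow (n + 1) k (by omega)
      rw [mul_add]
      omega

lemma aux_meas {Ω : Type*} [MeasurableSpace Ω] (Z : ℕ → Ω → ℝ) (hmeas : ∀ t, Measurable (Z t))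
    (b : ℝ) : Measurable (fun ω => sInf {t : ℕ | 1 ≤ t ∧ Z t ω ≥ b}) := by
  apply measurable_of_Iic
  intro n
  have : (fun ω => sInf {t : ℕ | 1 ≤ t ∧ Z t ω ≥ b}) ⁻¹' Set.Iic n =
      {ω | (∃ t, t ≤ n ∧ 1 ≤ t ∧ Z t ω ≥ b) ∨ ∀ t, ¬ (1 ≤ t ∧ Z t ω ≥ b)} := by
    ext ω
    simp only [Set.mem_preimage, Set.mem_Iic, Set.mem_setOf_eq]
    constructor
    · intro h
      by_cases hne : {t : ℕ | 1 ≤ t ∧ Z t ω ≥ b}.Nonempty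
      · exact Or.inl ⟨_, h, Nat.sInf_mem hne⟩
      · right
        intro t ht
        exact hne ⟨t, ht⟩
    · rintro (⟨t, ht, h⟩ | h)
      · exact (Nat.sInf_le h).trans ht
      · have : {t : ℕ | 1 ≤ t ∧ Z t ω ≥ b} = ∅ := Set.eq_empty_of_forall_notMem h
        rw [this]; simp
  rw [this]
  have hA : ∀ t, MeasurableSet {ω | 1 ≤ t ∧ Z t ω ≥ b} := fun t =>
    (MeasurableSet.const _).inter (measurableSet_le measurable_const (hmeas t))
  refine MeasurableSet.union (s₁ := {ω | ∃ t, t ≤ n ∧ 1 ≤ t ∧ Z t ω ≥ b})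
    (s₂ := {ω | ∀ t, ¬ (1 ≤ t ∧ Z t ω ≥ b)}) ?_ ?_
  · have : {ω | ∃ t, t ≤ n ∧ 1 ≤ t ∧ Z t ω ≥ b} =
      ⋃ t, ({ω | t ≤ n} ∩ {ω | 1 ≤ t ∧ Z t ω ≥ b}) := by ext; simp
    rw [this]
    exact MeasurableSet.iUnion fun t => (MeasurableSet.const _).inter (hA t)
  · have : {ω | ∀ t, ¬ (1 ≤ t ∧ Z t ω ≥ b)} = ⋂ t, {ω | 1 ≤ t ∧ Z t ω ≥ b}ᶜ := by
      ext; simp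
    rw [this]
    exact MeasurableSet.iInter fun t => (hA t).compl

lemma aux_lim (z : ℕ → ℝ) (I : ℝ) (hI : 0 < I)
    (hz : Tendsto (fun t : ℕ => z t / t) atTop (nhds I)) :
    Tendsto (fun b : ℝ => ((sInf {t : ℕ | 1 ≤ t ∧ z t ≥ b} : ℕ) : ℝ) / b) atTop
      (nhds (1 / I)) := by
  have hzinf : Tendsto z atTop atTop := by
    have h := hz.pos_mul_atTop hI tendsto_natCast_atTop_atTop
    refine h.congr' ?_
    filter_upwards [eventually_ge_atTop 1] with t ht
    have : (t : ℝ) ≠ 0 := by positivity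
    field_simp
  have hne : ∀ b, {t : ℕ | 1 ≤ t ∧ z t ≥ b}.Nonempty := by
    intro b
    obtain ⟨t, h⟩ := ((eventually_ge_atTop 1).and (hzinf.eventually_ge_atTop b)).exists
    exact ⟨t, h⟩
  set T : ℝ → ℕ := fun b => sInf {t : ℕ | 1 ≤ t ∧ z t ≥ b} with hT
  have hTmem : ∀ b, 1 ≤ T b ∧ z (T b) ≥ b := fun b => Nat.sInf_mem (hne b)
  have hTinf : Tendsto T atTop atTop := by
    rw [tendsto_atTop]
    intro M
    have : ∀ᶠ b : ℝ in atTop, ∀ t ∈ Finset.range M, z t < b := by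
      rw [Filter.eventually_all_finset]
      intro t _
      exact eventually_gt_atTop _
    filter_upwards [this] with b hb
    by_contra hlt
    exact absurd (hTmem b).2 (not_le.2 (hb _ (Finset.mem_range.2 (not_le.1 hlt))))
  have hT1 : Tendsto (fun b => T b - 1) atTop atTop := (tendsto_sub_atTop_nat 1).comp hTinf
  have hup : Tendsto (fun b => z (T b) / (T b : ℝ)) atTop (nhds I) := hz.comp hTinf
  have hlow : Tendsto (fun b => z (T b - 1) / (T b : ℝ)) atTop (nhds I) := by
    have h1 : Tendsto (fun b => z (T b - 1) / ((T b - 1 : ℕ) : ℝ)) atTop (nhds I) := hz.comp hT1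
    have h2 : Tendsto (fun b => 1 - 1 / (T b : ℝ)) atTop (nhds (1 - 0)) :=
      tendsto_const_nhds.sub (tendsto_one_div_atTop_nhds_zero_nat.comp hTinf)
    have h3 := h1.mul h2
    simp only [sub_zero, mul_one] at h3
    refine h3.congr' ?_
    filter_upwards [hTinf.eventually_ge_atTop 2] with b hb
    have hc : ((T b - 1 : ℕ) : ℝ) = (T b : ℝ) - 1 := by
      rw [Nat.cast_sub (by omega)]; simp
    have hb' : (2 : ℝ) ≤ T b := by exact_mod_cast hb
    rw [hc]
    have h0 : (T b : ℝ) - 1 ≠ 0 := by linarith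
    have h00 : (T b : ℝ) ≠ 0 := by linarith
    field_simp
  have hmid : Tendsto (fun b => b / (T b : ℝ)) atTop (nhds I) := by
    refine tendsto_of_tendsto_of_tendsto_of_le_of_le' hlow hup ?_ ?_
    · filter_upwards [hTinf.eventually_ge_atTop 2] with b hb
      have hnm : T b - 1 ∉ {t : ℕ | 1 ≤ t ∧ z t ≥ b} :=
        Nat.notMem_of_lt_sInf (show T b - 1 < T b by omega)
      have : z (T b - 1) < b := by
        by_contra h
        exact hnm ⟨by omega, not_lt.1 h⟩
      gcongr
    · filter_upwards with b
      have := (hTmem b).2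
      gcongr
  have := hmid.inv₀ hI.ne'
  rw [one_div]
  refine this.congr fun b => ?_
  rw [inv_div]

/-- Let `T_b = inf{t ≥ 1 : Z_t ≥ b}` and suppose `(1/t)Z_t` converges `r`-completely to
`I ∈ (0,∞)` for an integer `r ≥ 1`, i.e. `∑_t t^{r−1} P(|Z_t/t − I| > ε) < ∞` for all
`ε > 0`. Then `E[T_b^r]/b^r → I^{−r}` as `b → ∞` (the limsup upper bound combined with
the matching SLLN lower bound). -/
theorem stmt19 {Ω : Type*} [MeasurableSpace Ω] (μ : Measure Ω) [IsProbabilityMeasure μ]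
    (Z : ℕ → Ω → ℝ) (hmeas : ∀ t, Measurable (Z t)) (I : ℝ) (hI : 0 < I)
    (r : ℕ) (hr : 1 ≤ r)
    (hrc : ∀ ε > (0 : ℝ), ∑' t : ℕ,
      ((t + 1 : ℕ) : ℝ≥0∞) ^ (r - 1) *
        μ {ω | |Z (t + 1) ω / (t + 1) - I| > ε} < ⊤) :
    Tendsto (fun b : ℝ =>
        (∫ ω, ((sInf {t : ℕ | 1 ≤ t ∧ Z t ω ≥ b} : ℕ) : ℝ) ^ r ∂μ) / b ^ r)
      atTop (nhds ((1 / I) ^ r)) := by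
  classical
  obtain ⟨k, rfl⟩ : ∃ k, r = k + 1 := ⟨r - 1, by omega⟩
  simp only [Nat.add_sub_cancel] at hrc
  -- almost sure convergence
  have hae : ∀ᵐ ω ∂μ, Tendsto (fun t : ℕ => Z t ω / t) atTop (nhds I) := by
    have h1 : ∀ n : ℕ, ∀ᵐ ω ∂μ, ∀ᶠ t : ℕ in atTop,
        ω ∉ {ω | |Z (t + 1) ω / (t + 1) - I| > 1 / ((n : ℝ) + 1)} := by
      intro n
      apply ae_eventually_notMem
      refine ne_top_of_le_ne_top (hrc (1 / ((n : ℝ) + 1)) (by positivity)).ne ?_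
      refine ENNReal.tsum_le_tsum fun t => ?_
      refine le_mul_of_one_le_left zero_le ?_
      apply one_le_pow₀
      exact_mod_cast Nat.le_add_left 1 t
    rw [← ae_all_iff] at h1
    filter_upwards [h1] with ω hω
    rw [← tendsto_add_atTop_iff_nat 1, Metric.tendsto_atTop']
    intro ε hε
    obtain ⟨n, hn⟩ := exists_nat_one_div_lt hε
    obtain ⟨M, hM⟩ := eventually_atTop.1 (hω n)
    refine ⟨M, fun t ht => ?_⟩
    have := hM t ht.le
    simp only [Set.mem_setOf_eq, not_lt, gt_iff_lt] at this
    rw [Real.dist_eq]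
    push_cast
    exact this.trans_lt hn
  set Bad : ℕ → Set Ω := fun t => {ω | |Z (t + 1) ω / (t + 1) - I| > I / 4} with hBad
  have hBm : ∀ t, MeasurableSet (Bad t) := fun t =>
    measurableSet_lt measurable_const ((((hmeas (t+1)).div_const _).sub_const _).abs)
  set W : Ω → ℝ≥0∞ := fun ω => ∑' t : ℕ, (Bad t).indicator (fun _ => ((t + 1 : ℕ) : ℝ≥0∞) ^ k) ω
    with hW
  have hWm : Measurable W := Measurable.ennreal_tsum fun t => measurable_const.indicator (hBm t)
  have hWi : ∫⁻ ω, W ω ∂μ ≠ ⊤ := by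
    rw [hW, lintegral_tsum fun t => (measurable_const.indicator (hBm t)).aemeasurable]
    simp only [lintegral_indicator_const (hBm _)]
    exact (hrc (I / 4) (by positivity)).ne
  have hWf : ∀ᵐ ω ∂μ, W ω < ⊤ := ae_lt_top hWm hWi
  have hWint : Integrable (fun ω => (W ω).toReal) μ :=
    integrable_toReal_of_lintegral_ne_top hWm.aemeasurable hWi
  have hfun : (fun b : ℝ =>
        (∫ ω, ((sInf {t : ℕ | 1 ≤ t ∧ Z t ω ≥ b} : ℕ) : ℝ) ^ (k + 1) ∂μ) / b ^ (k + 1)) =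
      fun b => ∫ ω, (((sInf {t : ℕ | 1 ≤ t ∧ Z t ω ≥ b} : ℕ) : ℝ) / b) ^ (k + 1) ∂μ := by
    funext b
    rw [← integral_div]
    simp only [div_pow]
  have hlim : (1 / I) ^ (k + 1) = ∫ _ω : Ω, (1 / I) ^ (k + 1) ∂μ := by simp
  rw [hfun, hlim]
  refine tendsto_integral_filter_of_dominated_convergence
    (fun ω => (2 / I + 2) ^ (k + 1) + 2 ^ (k + 1) * (W ω).toReal) ?_ ?_ ?_ ?_
  · refine Eventually.of_forall fun b => ?_
    exact (((measurable_from_top (f := fun n : ℕ => (n : ℝ))).comp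
      (aux_meas Z hmeas b)).div_const b |>.pow_const _).aestronglyMeasurable
  · filter_upwards [eventually_ge_atTop 1] with b hb
    filter_upwards [hWf] with ω hω
    have hb0 : 0 < b := by linarith
    set T := sInf {t : ℕ | 1 ≤ t ∧ Z t ω ≥ b} with hT
    set N := ⌈2 * b / I⌉₊ with hN
    have hkey := aux_bound (fun s => ω ∈ Bad s) k N T (by
      intro s hs hsT
      have hnm := Nat.notMem_of_lt_sInf hsT
      have hz : Z (s + 1) ω < b := by
        by_contra h
        exact hnm ⟨by omega, not_lt.1 h⟩
      have h1 : 2 * b / I < (s : ℝ) + 1 := by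
        have := (Nat.le_ceil (2 * b / I)).trans_lt (Nat.cast_lt.2 hs)
        exact_mod_cast this
      have hs0 : (0 : ℝ) < (s : ℝ) + 1 := by positivity
      have h2 : Z (s + 1) ω / ((s : ℝ) + 1) < I / 2 := by
        rw [div_lt_iff₀ hs0]
        rw [div_lt_iff₀ hI] at h1
        nlinarith
      show |Z (s + 1) ω / ((s : ℝ) + 1) - I| > I / 4
      rw [gt_iff_lt, lt_abs]
      right
      linarith)
    have hsumle : ∀ n, ((∑ s ∈ Finset.range n, (if ω ∈ Bad s then (s + 1) ^ k else 0) : ℕ) : ℝ)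
        ≤ (W ω).toReal := by
      intro n
      have h : ((∑ s ∈ Finset.range n, (if ω ∈ Bad s then (s + 1) ^ k else 0) : ℕ) : ℝ≥0∞)
          ≤ W ω := by
        refine le_trans (le_of_eq ?_) (ENNReal.sum_le_tsum (Finset.range n))
        rw [Nat.cast_sum]
        refine Finset.sum_congr rfl fun s _ => ?_
        by_cases hs : ω ∈ Bad s <;> simp [hs]
      have := ENNReal.toReal_mono hω.ne h
      simpa only [ENNReal.toReal_natCast] using this
    have hTb : (T : ℝ) ^ (k + 1) ≤ ((N : ℝ) + 1) ^ (k + 1) + 2 ^ (k + 1) * (W ω).toReal := by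
      rcases Nat.eq_zero_or_pos T with h0 | hpos
      · rw [h0]
        have : (0 : ℝ) ≤ (W ω).toReal := ENNReal.toReal_nonneg
        simp only [Nat.cast_zero, ne_eq, Nat.add_eq_zero_iff, one_ne_zero, and_false,
          not_false_eq_true, zero_pow]
        positivity
      · have h := hkey (T - 1) (by omega)
        rw [Nat.sub_add_cancel hpos] at h
        have h' : (T : ℝ) ^ (k + 1) ≤ ((N : ℝ) + 1) ^ (k + 1) + 2 ^ (k + 1) *
          ((∑ s ∈ Finset.range (T - 1), (if ω ∈ Bad s then (s + 1) ^ k else 0) : ℕ) : ℝ) := by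
          exact_mod_cast h
        refine h'.trans ?_
        gcongr
        exact hsumle _
    have hN1 : (N : ℝ) + 1 ≤ (2 / I + 2) * b := by
      have : (N : ℝ) < 2 * b / I + 1 := Nat.ceil_lt_add_one (by positivity)
      have e : (2 / I + 2) * b = 2 * b / I + 2 * b := by ring
      linarith
    have hbp : (1 : ℝ) ≤ b ^ (k + 1) := one_le_pow₀ hb
    rw [Real.norm_of_nonneg (by positivity), div_pow, div_le_iff₀ (by positivity)]
    refine hTb.trans ?_
    have h5 : ((N : ℝ) + 1) ^ (k + 1) ≤ (2 / I + 2) ^ (k + 1) * b ^ (k + 1) := by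
      rw [← mul_pow]
      gcongr
    rw [add_mul]
    refine add_le_add h5 (le_mul_of_one_le_right ?_ hbp)
    have : (0 : ℝ) ≤ (W ω).toReal := ENNReal.toReal_nonneg
    positivity
  · exact (integrable_const _).add (hWint.const_mul _)
  · filter_upwards [hae] with ω hω
    exact (aux_lim (fun t => Z t ω) I hI hω).pow _
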